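/- Let C = [C_1,…,C_r] be the W-characteristic set of ⟨P⟩. Then prem(F, C) = 0 for every polynomial F ∈ ⟨P⟩. -/

import Mathlib

open MvPolynomial

namespace CharSets

variable {n : ℕ} {K : Type*} [Field K]

/-- The coefficient of `x_i ^ d` in `F`, as a polynomial in the remaining variables. -/
noncomputable def coefv (i : Fin n) (d : ℕ) (F : MvPolynomial (Fin n) K) :
    MvPolynomial (Fin n) K :=
  ∑ m ∈ F.support.filter (fun m => m i = d), monomial (Finsupp.erase i m) (F.coeff m)

/-- The leading coefficient of `F` with respect to the variable `x_i`. -/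
noncomputable def lcv (i : Fin n) (F : MvPolynomial (Fin n) K) : MvPolynomial (Fin n) K :=
  coefv i (F.degreeOf i) F

/-- Auxiliary pseudo-division: computes (pseudo-quotient, pseudo-remainder) pairs,
with the first argument as fuel; the total power of the leading coefficient used is
exactly the fuel, so that starting with fuel `max(l - m + 1, 0)` yields the pair
`(Q, R)` of the unique representation `lc(F,x_i)^q • G = Q*F + R` with
`q = max(l - m + 1, 0)` and `deg(R, x_i) < deg(F, x_i)`. -/
noncomputable def pdivAux (i : Fin n) (F : MvPolynomial (Fin n) K) :
    ℕ → MvPolynomial (Fin n) K × MvPolynomial (Fin n) K →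
      MvPolynomial (Fin n) K × MvPolynomial (Fin n) K
  | 0, QR => QR
  | q + 1, QR =>
    if (QR.2).degreeOf i < F.degreeOf i then
      (lcv i F ^ (q + 1) * QR.1, lcv i F ^ (q + 1) * QR.2)
    else
      pdivAux i F q
        (lcv i F * QR.1 +
            coefv i ((QR.2).degreeOf i) QR.2 * X i ^ ((QR.2).degreeOf i - F.degreeOf i),
          lcv i F * QR.2 -
            coefv i ((QR.2).degreeOf i) QR.2 * X i ^ ((QR.2).degreeOf i - F.degreeOf i) * F)

/-- The pseudo-remainder `prem(G, F, x_i)`. -/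
noncomputable def prem (G F : MvPolynomial (Fin n) K) (i : Fin n) : MvPolynomial (Fin n) K :=
  (pdivAux i F (G.degreeOf i + 1 - F.degreeOf i) (0, G)).2

/-- The pseudo-quotient `pquo(G, F, x_i)`. -/
noncomputable def pquo (G F : MvPolynomial (Fin n) K) (i : Fin n) : MvPolynomial (Fin n) K :=
  (pdivAux i F (G.degreeOf i + 1 - F.degreeOf i) (0, G)).1

/-- The class of `P`: the largest index (1-based) of a variable actually occurring in `P`;
the class of a constant is `0`. -/
noncomputable def cls (P : MvPolynomial (Fin n) K) : ℕ :=
  P.vars.sup fun i => (i : ℕ) + 1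

/-- The degree of `G` in the leading variable of `P` (`0` if `P` is constant). -/
noncomputable def degLv (G P : MvPolynomial (Fin n) K) : ℕ :=
  if h : P.vars.Nonempty then G.degreeOf (P.vars.max' h) else 0

/-- `G` is R-reduced with respect to `P`, i.e. `deg(G, lv(P)) < deg(P, lv(P))`. -/
def RReduced (G P : MvPolynomial (Fin n) K) : Prop :=
  degLv G P < degLv P P

/-- The initial of `P`: its leading coefficient w.r.t. its leading variable. -/
noncomputable def ini (P : MvPolynomial (Fin n) K) : MvPolynomial (Fin n) K :=
  if h : P.vars.Nonempty then lcv (P.vars.max' h) P else P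

/-- Pseudo-remainder of `G` w.r.t. `F` in the leading variable of `F`
(in case `F` is constant, `m = 0` and the pseudo-remainder is `0`). -/
noncomputable def premLv (G F : MvPolynomial (Fin n) K) : MvPolynomial (Fin n) K :=
  if h : F.vars.Nonempty then prem G F (F.vars.max' h) else 0

/-- Pseudo-quotient of `G` w.r.t. `F` in the leading variable of `F`. -/
noncomputable def pquoLv (G F : MvPolynomial (Fin n) K) : MvPolynomial (Fin n) K :=
  if h : F.vars.Nonempty then pquo G F (F.vars.max' h) else 0

/-- Iterated pseudo-remainder with respect to a triangular set `[T_1, …, T_r]`: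
`prem(P, T) = prem(⋯prem(P, T_r, lv(T_r)), …, T_1, lv(T_1))`. -/
noncomputable def premTS (P : MvPolynomial (Fin n) K) (L : List (MvPolynomial (Fin n) K)) :
    MvPolynomial (Fin n) K :=
  L.foldr (fun T acc => premLv acc T) P

/-- The Sylvester matrix of `F` and `G` with respect to the variable `x_i`. -/
noncomputable def sylvester (i : Fin n) (F G : MvPolynomial (Fin n) K) :
    Matrix (Fin (G.degreeOf i + F.degreeOf i)) (Fin (G.degreeOf i + F.degreeOf i))
      (MvPolynomial (Fin n) K) :=
  Matrix.of fun r c =>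
    if (r : ℕ) < G.degreeOf i then
      if (r : ℕ) ≤ (c : ℕ) ∧ (c : ℕ) ≤ (r : ℕ) + F.degreeOf i then
        coefv i (F.degreeOf i + (r : ℕ) - (c : ℕ)) F
      else 0
    else
      if (r : ℕ) - G.degreeOf i ≤ (c : ℕ) ∧ (c : ℕ) ≤ (r : ℕ) then
        coefv i (G.degreeOf i + ((r : ℕ) - G.degreeOf i) - (c : ℕ)) G
      else 0

/-- The resultant `res(F, G, x_i)` of `F` and `G` w.r.t. `x_i`
(the determinant of the Sylvester matrix). -/
noncomputable def resv (F G : MvPolynomial (Fin n) K) (i : Fin n) : MvPolynomial (Fin n) K :=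
  (sylvester i F G).det

/-- Resultant of `F` and `G` w.r.t. the leading variable of `G`. -/
noncomputable def resLv (F G : MvPolynomial (Fin n) K) : MvPolynomial (Fin n) K :=
  if h : G.vars.Nonempty then resv F G (G.vars.max' h) else F

/-- Iterated resultant with respect to a triangular set:
`res(F, T) = res(⋯res(F, T_r, lv(T_r)), …, T_1, lv(T_1))`. -/
noncomputable def resTS (F : MvPolynomial (Fin n) K) (L : List (MvPolynomial (Fin n) K)) :
    MvPolynomial (Fin n) K :=
  L.foldr (fun T acc => resLv acc T) F

/-- A triangular set: a nonempty ordered set of nonconstant polynomials with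
strictly increasing classes. -/
def TriangularSet (L : List (MvPolynomial (Fin n) K)) : Prop :=
  L ≠ [] ∧ (∀ T ∈ L, 0 < cls T) ∧ L.Chain' fun A B => cls A < cls B

/-- An ascending set: either a single nonzero constant, or a triangular set in which
every later element is R-reduced with respect to every earlier one. -/
def AscendingSet (L : List (MvPolynomial (Fin n) K)) : Prop :=
  (∃ a : K, a ≠ 0 ∧ L = [MvPolynomial.C a]) ∨
    (TriangularSet L ∧ L.Pairwise fun A B => RReduced B A)

/-- `F` has lower rank than `G`. -/
def rkLT (F G : MvPolynomial (Fin n) K) : Prop :=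
  cls F < cls G ∨ (cls F = cls G ∧ 0 < cls F ∧ degLv F F < degLv G G)

/-- `F` and `G` have the same rank: neither has lower rank than the other. -/
def rkEQ (F G : MvPolynomial (Fin n) K) : Prop :=
  ¬ rkLT F G ∧ ¬ rkLT G F

/-- `B` has lower rank than `A` (as ascending sets). -/
def ascLT (B A : List (MvPolynomial (Fin n) K)) : Prop :=
  (∃ j, j < min A.length B.length ∧
      (∀ i, i < j → rkEQ (A.getD i 0) (B.getD i 0)) ∧ rkLT (B.getD j 0) (A.getD j 0)) ∨
    (A.length < B.length ∧ ∀ i, i < A.length → rkEQ (A.getD i 0) (B.getD i 0))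

/-- A Ritt characteristic set of the ideal `I`: an ascending set contained in `I`
of minimal rank among all ascending sets contained in `I`. -/
def RittCharSet (I : Ideal (MvPolynomial (Fin n) K)) (A : List (MvPolynomial (Fin n) K)) :
    Prop :=
  AscendingSet A ∧ (∀ a ∈ A, a ∈ I) ∧
    ∀ B : List (MvPolynomial (Fin n) K), AscendingSet B → (∀ b ∈ B, b ∈ I) → ¬ ascLT B A

/-- The saturated ideal of a triangular set, as a set of polynomials. -/
def satTS (L : List (MvPolynomial (Fin n) K)) : Set (MvPolynomial (Fin n) K) :=
  {F | ∃ q : ℕ, 0 < q ∧ (L.map ini).prod ^ q * F ∈ Ideal.span {T | T ∈ L}}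

/-- A regular set: a triangular set such that `res(ini(T_j), [T_1, …, T_{j-1}]) ≠ 0`
for `j = 2, …, r`. -/
def RegularSet (L : List (MvPolynomial (Fin n) K)) : Prop :=
  TriangularSet L ∧
    ∀ j : ℕ, 0 < j → j < L.length → resTS (ini (L.getD j 0)) (L.take j) ≠ 0

/-- A normal triangular set: `deg(ini(T_j), lv(T_i)) = 0` for all `i < j`. -/
def NormalSet (L : List (MvPolynomial (Fin n) K)) : Prop :=
  TriangularSet L ∧ L.Pairwise fun A B => degLv (ini B) A = 0

/-- The purely lexicographical order on monomials determined by `x_1 < ⋯ < x_n`. -/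
def plexLT (a b : Fin n →₀ ℕ) : Prop :=
  ∃ k : Fin n, a k < b k ∧ ∀ j : Fin n, k < j → a j = b j

/-- `m` is the leading monomial of `P` w.r.t. the plex order. -/
def IsLpp (P : MvPolynomial (Fin n) K) (m : Fin n →₀ ℕ) : Prop :=
  m ∈ P.support ∧ ∀ m' ∈ P.support, m' ≠ m → plexLT m' m

/-- `G` is the reduced (Buchberger–)Gröbner basis of the ideal `I` w.r.t. the plex
term order determined by `x_1 < ⋯ < x_n`: its elements are nonzero monic members of `I`,
the leading monomial of every nonzero member of `I` is divisible by the leading monomial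
of some element of `G`, every element of `G` is B-reduced w.r.t. the others, and `G`
generates `I`. -/
def IsReducedGB (I : Ideal (MvPolynomial (Fin n) K)) (G : Finset (MvPolynomial (Fin n) K)) :
    Prop :=
  (∀ g ∈ G, g ∈ I ∧ g ≠ 0 ∧ ∀ m, IsLpp g m → g.coeff m = 1) ∧
    (∀ F ∈ I, F ≠ 0 → ∃ g ∈ G, ∃ mg mF, IsLpp g mg ∧ IsLpp F mF ∧ mg ≤ mF) ∧
    (∀ g ∈ G, ∀ g' ∈ G, g' ≠ g → ∀ m ∈ g.support, ∀ m', IsLpp g' m' → ¬ m' ≤ m) ∧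
    Ideal.span (G : Set (MvPolynomial (Fin n) K)) = I

/-- `Cs` is the W-characteristic set of `I`: the minimal triangular set contained in the
reduced plex Gröbner basis `G` of `I`, i.e. for each class realized in `G`, `Cs` contains
the element of that class whose leading monomial is minimal w.r.t. the plex order, the
elements being ordered by increasing class (equivalently, by the plex order). -/
def IsWCharSet (I : Ideal (MvPolynomial (Fin n) K)) (Cs : List (MvPolynomial (Fin n) K)) :
    Prop :=
  ∃ G : Finset (MvPolynomial (Fin n) K), IsReducedGB I G ∧
    (Cs.Chain' fun A B => cls A < cls B) ∧
    (∀ c ∈ Cs, c ∈ G) ∧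
    (∀ g ∈ G, ∃ c ∈ Cs, cls c = cls g) ∧
    ∀ c ∈ Cs, ∀ g ∈ G, cls g = cls c → g ≠ c →
      ∃ mc mg, IsLpp c mc ∧ IsLpp g mg ∧ plexLT mc mg

/-- The set of common zeros of a set `S` of polynomials over `k`, taken in `Kc ^ n`
for an extension `Kc` of `k`. -/
def zeroSet {k : Type*} [Field k] (Kc : Type*) [CommRing Kc] [Algebra k Kc]
    (S : Set (MvPolynomial (Fin n) k)) : Set (Fin n → Kc) :=
  {a | ∀ p ∈ S, MvPolynomial.aeval a p = 0}


theorem degreeOf_coefv_le (i k : Fin n) (d : ℕ) (F : MvPolynomial (Fin n) K) :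
    (coefv i d F).degreeOf k ≤ F.degreeOf k := by
  refine (degreeOf_sum_le _ _ _).trans (Finset.sup_le fun m hm => ?_)
  rw [Finset.mem_filter] at hm
  rw [degreeOf_monomial_eq _ _ (mem_support_iff.mp hm.1), Finsupp.erase_apply]
  split_ifs
  · exact Nat.zero_le _
  · exact monomial_le_degreeOf k hm.1

theorem degreeOf_coefv_self (i : Fin n) (d : ℕ) (F : MvPolynomial (Fin n) K) :
    (coefv i d F).degreeOf i = 0 := by
  refine Nat.le_zero.mp <| (degreeOf_sum_le _ _ _).trans (Finset.sup_le fun m hm => ?_)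
  rw [Finset.mem_filter] at hm
  rw [degreeOf_monomial_eq _ _ (mem_support_iff.mp hm.1), Finsupp.erase_same]

theorem degreeOf_pow_mul_le {i : Fin n} {A : MvPolynomial (Fin n) K} (hA : A.degreeOf i = 0)
    (q : ℕ) (B : MvPolynomial (Fin n) K) : (A ^ q * B).degreeOf i ≤ B.degreeOf i := by
  refine (degreeOf_mul_le _ _ _).trans ?_
  have := degreeOf_pow_le i A q
  simp [hA] at this
  omega

/-- The part of `F` that remains after removing its leading term in `x_i` has smaller degree. -/
theorem exists_eq_lcv_mul_add (i : Fin n) {F : MvPolynomial (Fin n) K} (hF : 0 < F.degreeOf i) :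
    ∃ F' : MvPolynomial (Fin n) K,
      F = lcv i F * X i ^ F.degreeOf i + F' ∧ F'.degreeOf i < F.degreeOf i := by
  refine ⟨∑ m ∈ F.support.filter (fun m => ¬ m i = F.degreeOf i), monomial m (F.coeff m), ?_, ?_⟩
  · have h : lcv i F * X i ^ F.degreeOf i =
        ∑ m ∈ F.support.filter (fun m => m i = F.degreeOf i), monomial m (F.coeff m) := by
      rw [lcv, coefv, Finset.sum_mul]
      refine Finset.sum_congr rfl fun m hm => ?_
      rw [X_pow_eq_monomial, monomial_mul, mul_one, ← (Finset.mem_filter.mp hm).2,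
        Finsupp.erase_add_single]
    rw [h, Finset.sum_filter_add_sum_filter_not]
    exact F.as_sum
  · refine (degreeOf_sum_le _ _ _).trans_lt ((Finset.sup_lt_iff hF).mpr fun m hm => ?_)
    rw [Finset.mem_filter] at hm
    rw [degreeOf_monomial_eq _ _ (mem_support_iff.mp hm.1)]
    exact lt_of_le_of_ne (monomial_le_degreeOf i hm.1) hm.2

theorem degreeOf_reduction_lt {i : Fin n} {F R : MvPolynomial (Fin n) K}
    (hF : 0 < F.degreeOf i) (hR : F.degreeOf i ≤ R.degreeOf i) :
    (lcv i F * R -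
      coefv i (R.degreeOf i) R * X i ^ (R.degreeOf i - F.degreeOf i) * F).degreeOf i <
      R.degreeOf i := by
  obtain ⟨F', hF', hdF⟩ := exists_eq_lcv_mul_add i hF
  obtain ⟨R', hR', hdR⟩ := exists_eq_lcv_mul_add i (hF.trans_le hR)
  have hX : (X i : MvPolynomial (Fin n) K) ^ R.degreeOf i =
      X i ^ (R.degreeOf i - F.degreeOf i) * X i ^ F.degreeOf i := by
    rw [← pow_add, Nat.sub_add_cancel hR]
  have key : lcv i F * R -
      coefv i (R.degreeOf i) R * X i ^ (R.degreeOf i - F.degreeOf i) * F =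
      lcv i F * R' - lcv i R * (X i ^ (R.degreeOf i - F.degreeOf i) * F') := by
    change lcv i F * R - lcv i R * X i ^ (R.degreeOf i - F.degreeOf i) * F = _
    linear_combination lcv i F * hR' -
      lcv i R * X i ^ (R.degreeOf i - F.degreeOf i) * hF' + lcv i F * lcv i R * hX
  rw [key]
  have h1 : (lcv i F).degreeOf i = 0 := degreeOf_coefv_self _ _ _
  have h2 : (lcv i R).degreeOf i = 0 := degreeOf_coefv_self _ _ _
  have h3 := degreeOf_sub_le i (lcv i F * R')
    (lcv i R * (X i ^ (R.degreeOf i - F.degreeOf i) * F'))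
  have h4 := degreeOf_mul_le i (lcv i F) R'
  have h5 := degreeOf_mul_le i (lcv i R) (X i ^ (R.degreeOf i - F.degreeOf i) * F')
  have h6 := degreeOf_mul_le i (X i ^ (R.degreeOf i - F.degreeOf i)) F'
  have h7 := degreeOf_pow_le i (X i : MvPolynomial (Fin n) K) (R.degreeOf i - F.degreeOf i)
  rw [degreeOf_X_self, mul_one] at h7
  omega

theorem pdivAux_snd_mem (i : Fin n) {I : Ideal (MvPolynomial (Fin n) K)}
    {F : MvPolynomial (Fin n) K} (hF : F ∈ I) (q : ℕ) :
    ∀ QR : MvPolynomial (Fin n) K × MvPolynomial (Fin n) K, QR.2 ∈ I →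
      (pdivAux i F q QR).2 ∈ I := by
  induction q with
  | zero => exact fun QR h => h
  | succ q ih =>
    intro QR h
    rw [pdivAux]
    split_ifs
    · exact I.mul_mem_left _ h
    · exact ih _ (I.sub_mem (I.mul_mem_left _ h) (I.mul_mem_left _ hF))

theorem degreeOf_pdivAux_snd_le {i k : Fin n} (hik : k ≠ i) {F : MvPolynomial (Fin n) K}
    (hF : F.degreeOf k = 0) (q : ℕ) :
    ∀ QR : MvPolynomial (Fin n) K × MvPolynomial (Fin n) K,
      (pdivAux i F q QR).2.degreeOf k ≤ QR.2.degreeOf k := by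
  have hl : (lcv i F).degreeOf k = 0 :=
    Nat.le_zero.mp ((degreeOf_coefv_le _ _ _ _).trans hF.le)
  induction q with
  | zero => exact fun QR => le_rfl
  | succ q ih =>
    intro QR
    rw [pdivAux]
    split_ifs
    · exact degreeOf_pow_mul_le hl _ _
    · refine (ih _).trans ((degreeOf_sub_le _ _ _).trans (max_le ?_ ?_))
      · simpa using degreeOf_pow_mul_le hl 1 QR.2
      · refine (degreeOf_mul_le _ _ _).trans ?_
        rw [hF, add_zero]
        refine (degreeOf_mul_le _ _ _).trans ?_
        rw [degreeOf_X_pow_of_ne _ hik, add_zero]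
        exact degreeOf_coefv_le _ _ _ _

theorem degreeOf_pdivAux_snd_lt {i : Fin n} {F : MvPolynomial (Fin n) K}
    (hF : 0 < F.degreeOf i) (q : ℕ) :
    ∀ QR : MvPolynomial (Fin n) K × MvPolynomial (Fin n) K,
      QR.2.degreeOf i < F.degreeOf i + q → (pdivAux i F q QR).2.degreeOf i < F.degreeOf i := by
  induction q with
  | zero => exact fun QR h => h
  | succ q ih =>
    intro QR h
    rw [pdivAux]
    split_ifs with hlt
    · exact (degreeOf_pow_mul_le (degreeOf_coefv_self _ _ _) _ _).trans_lt hlt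
    · refine ih _ ?_
      have := degreeOf_reduction_lt hF (not_lt.mp hlt)
      dsimp only
      omega

theorem degreeOf_prem_lt {i : Fin n} {F : MvPolynomial (Fin n) K} (hF : 0 < F.degreeOf i)
    (G : MvPolynomial (Fin n) K) : (prem G F i).degreeOf i < F.degreeOf i := by
  refine degreeOf_pdivAux_snd_lt hF _ _ ?_
  dsimp only
  omega

theorem cls_eq_max'_add_one {P : MvPolynomial (Fin n) K} (h : P.vars.Nonempty) :
    cls P = (P.vars.max' h : ℕ) + 1 := by
  refine le_antisymm (Finset.sup_le fun i hi => ?_) ?_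
  · exact Nat.succ_le_succ (Fin.le_def.mp (P.vars.le_max' i hi))
  · exact Finset.le_sup (f := fun i : Fin n => (i : ℕ) + 1) (P.vars.max'_mem h)

theorem degLv_self_pos {P : MvPolynomial (Fin n) K} (h : P.vars.Nonempty) :
    0 < degLv P P := by
  rw [degLv, dif_pos h]
  exact Nat.pos_of_ne_zero (mem_vars_iff_degreeOf_ne_zero.mp (P.vars.max'_mem h))

theorem rReduced_premLv {T : MvPolynomial (Fin n) K} (hT : T.vars.Nonempty)
    (G : MvPolynomial (Fin n) K) : RReduced (premLv G T) T := by
  have h := degLv_self_pos hT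
  rw [RReduced]
  simp only [degLv, premLv, dif_pos hT] at h ⊢
  exact degreeOf_prem_lt h G

theorem degLv_premLv_le {T B : MvPolynomial (Fin n) K} (hT : T.vars.Nonempty)
    (hB : B.vars.Nonempty) (hTB : cls T < cls B) (G : MvPolynomial (Fin n) K) :
    degLv (premLv G T) B ≤ degLv G B := by
  rw [cls_eq_max'_add_one hT, cls_eq_max'_add_one hB] at hTB
  have hlt : T.vars.max' hT < B.vars.max' hB := Fin.lt_def.mpr (Nat.lt_of_succ_lt_succ hTB)
  have h0 : T.degreeOf (B.vars.max' hB) = 0 := by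
    by_contra h
    exact absurd (T.vars.le_max' _ (mem_vars_iff_degreeOf_ne_zero.mpr h)) (not_le.mpr hlt)
  simp only [degLv, premLv, dif_pos hT, dif_pos hB]
  exact degreeOf_pdivAux_snd_le hlt.ne' h0 _ _

theorem premTS_mem {I : Ideal (MvPolynomial (Fin n) K)} {F : MvPolynomial (Fin n) K}
    (hF : F ∈ I) (L : List (MvPolynomial (Fin n) K)) (hL : ∀ T ∈ L, T ∈ I) :
    premTS F L ∈ I := by
  induction L with
  | nil => exact hF
  | cons T L ih =>
    have h := ih fun B hB => hL B (List.mem_cons_of_mem _ hB)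
    change premLv (premTS F L) T ∈ I
    rw [premLv]
    split_ifs
    · exact pdivAux_snd_mem _ (hL T List.mem_cons_self) _ _ h
    · exact I.zero_mem

/-- The iterated pseudo-remainder is R-reduced with respect to every element of a
triangular set. -/
theorem rReduced_premTS (F : MvPolynomial (Fin n) K) (L : List (MvPolynomial (Fin n) K))
    (hne : ∀ T ∈ L, T.vars.Nonempty) (hL : L.Pairwise fun A B => cls A < cls B) :
    ∀ T ∈ L, RReduced (premTS F L) T := by
  induction L with
  | nil => simp
  | cons T L ih =>
    rw [List.pairwise_cons] at hL
    have hT := hne T List.mem_cons_self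
    have hne' : ∀ B ∈ L, B.vars.Nonempty := fun B hB => hne B (List.mem_cons_of_mem _ hB)
    intro B hB
    change RReduced (premLv (premTS F L) T) B
    rcases List.mem_cons.mp hB with rfl | hB
    · exact rReduced_premLv hT _
    · exact (degLv_premLv_le hT (hne' B hB) (hL.1 B hB) _).trans_lt (ih hne' hL.2 B hB)

theorem apply_max'_le_of_plexLT {a b : Fin n →₀ ℕ} {i : Fin n} (hab : plexLT a b)
    (hb : ∀ j, i < j → b j = 0) : a i ≤ b i := by
  obtain ⟨k, hk, hj⟩ := hab
  rcases lt_trichotomy k i with h | rfl | h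
  · exact (hj i h).le
  · exact hk.le
  · simp [hb k h] at hk

theorem apply_eq_zero_of_max'_lt {P : MvPolynomial (Fin n) K} (h : P.vars.Nonempty)
    {m : Fin n →₀ ℕ} (hm : m ∈ P.support) (j : Fin n) (hj : P.vars.max' h < j) : m j = 0 := by
  by_contra hmj
  refine absurd (P.vars.le_max' j ?_) (not_le.mpr hj)
  exact (mem_vars_iff_mem_support j).mpr ⟨m, hm, Finsupp.mem_support_iff.mpr hmj⟩

theorem IsLpp.apply_max' {P : MvPolynomial (Fin n) K} (h : P.vars.Nonempty) {m : Fin n →₀ ℕ}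
    (hm : IsLpp P m) : m (P.vars.max' h) = degLv P P := by
  rw [degLv, dif_pos h]
  refine le_antisymm (monomial_le_degreeOf _ hm.1) (degreeOf_le_iff.mpr fun m' hm' => ?_)
  rcases eq_or_ne m' m with rfl | hne
  · exact le_rfl
  · exact apply_max'_le_of_plexLT (hm.2 m' hm' hne) (apply_eq_zero_of_max'_lt h hm.1)

theorem vars_nonempty_of_mem {I : Ideal (MvPolynomial (Fin n) K)} (hI : I ≠ ⊤)
    {g : MvPolynomial (Fin n) K} (hg : g ∈ I) (h0 : g ≠ 0) : g.vars.Nonempty := by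
  by_contra h
  rw [Finset.not_nonempty_iff_eq_empty, vars_eq_empty_iff_eq_C] at h
  have hc : g.coeff 0 ≠ 0 := fun hc => h0 (by rw [h, hc, C_0])
  refine hI (Ideal.eq_top_of_isUnit_mem I hg ?_)
  rw [h]
  exact (IsUnit.mk0 _ hc).map C

/-- Proposition charpro (a). Let `C` be the W-characteristic set of
`⟨P⟩`. Then `prem(F, C) = 0` for every `F ∈ ⟨P⟩`. -/
theorem statement6 {n : ℕ} {K : Type*} [Field K]
    (P : Finset (MvPolynomial (Fin n) K)) (hne : P.Nonempty) (h0 : ∀ p ∈ P, p ≠ 0)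
    (hproper : Ideal.span (P : Set (MvPolynomial (Fin n) K)) ≠ ⊤)
    (Cs : List (MvPolynomial (Fin n) K))
    (hW : IsWCharSet (Ideal.span (P : Set (MvPolynomial (Fin n) K))) Cs) :
    ∀ F ∈ Ideal.span (P : Set (MvPolynomial (Fin n) K)), premTS F Cs = 0 := by
  obtain ⟨G, ⟨hG, hlead, -, -⟩, hchain, hCG, hcls, hmin⟩ := hW
  intro F hF
  by_contra hR
  have hvars : ∀ g ∈ G, g.vars.Nonempty := fun g hg =>
    vars_nonempty_of_mem hproper (hG g hg).1 (hG g hg).2.1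
  have hpw : Cs.Pairwise fun A B => cls A < cls B := by
    have : IsTrans (MvPolynomial (Fin n) K) fun A B => cls A < cls B :=
      ⟨fun _ _ _ => lt_trans⟩
    exact List.isChain_iff_pairwise.mp hchain
  have hmem := premTS_mem hF Cs fun c hc => (hG c (hCG c hc)).1
  obtain ⟨g, hg, mg, mF, hmg, hmF, hle⟩ := hlead _ hmem hR
  obtain ⟨c, hc, hcg⟩ := hcls g hg
  have hcv := hvars c (hCG c hc)
  have hgv := hvars g hg
  have hred := rReduced_premTS F Cs (fun c hc => hvars c (hCG c hc)) hpw c hc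
  have hmax : c.vars.max' hcv = g.vars.max' hgv := by
    rw [cls_eq_max'_add_one hcv, cls_eq_max'_add_one hgv] at hcg
    exact Fin.ext (Nat.succ_injective hcg)
  have hcdeg : degLv c c ≤ mg (g.vars.max' hgv) := by
    rcases eq_or_ne g c with rfl | hne
    · exact (hmg.apply_max' hgv).ge
    · obtain ⟨mc, mg', hmc, hmg', hlt⟩ := hmin c hc g hg hcg.symm hne
      have h1 := apply_max'_le_of_plexLT hlt (apply_eq_zero_of_max'_lt hgv hmg'.1)
      rw [hmg'.apply_max' hgv, ← hmg.apply_max' hgv, ← hmax, hmc.apply_max' hcv, hmax] at h1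
      exact h1
  rw [RReduced] at hred
  have h2 := monomial_le_degreeOf (c.vars.max' hcv) hmF.1
  have h3 := hle (g.vars.max' hgv)
  rw [← hmax] at h3 hcdeg
  rw [degLv, dif_pos hcv] at hred
  omega

end CharSets
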